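/- Let D ⊂ ℝ^d be compact with D = closure(D°) and μ_d(∂D) = 0, and {f₁,…,f_k} injective contractions whose attractor has measure zero, such that μ_d(fᵢ(D) ∩ f_j(D)) = 0 for i ≠ j, Φ(D \ Φ(D)) ⊆ D, and Φ(D ∩ Φ²(D)) ⊆ D. Then D admits a dissection with respect to {f₁,…,f_k}. -/

import Mathlib

open MeasureTheory

/-- `Φ(X) = ⋃ i, fᵢ(X)`. -/
def PhiMap {d k : ℕ} (f : Fin k → EuclideanSpace ℝ (Fin d) → EuclideanSpace ℝ (Fin d)) :
    Set (EuclideanSpace ℝ (Fin d)) → Set (EuclideanSpace ℝ (Fin d)) :=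
  fun X => ⋃ i, f i '' X

open Module Set Metric Filter
open scoped Topology NNReal

section Degree

variable {E : Type*} [NormedAddCommGroup E] [NormedSpace ℝ E] [FiniteDimensional ℝ E]

theorem ContinuousLinearMap.det_one_add_eq_sum (A : E →L[ℝ] E) {v : ℕ → ℝ}
    (hv : InjOn v (Finset.range (finrank ℝ E + 1))) :
    (1 + A).det = ∑ j ∈ Finset.range (finrank ℝ E + 1),
      (1 + v j • A).det * (Lagrange.basis (Finset.range (finrank ℝ E + 1)) v j).eval 1 := by
  let b := finBasis ℝ E
  let M := LinearMap.toMatrix b b (A : E →ₗ[ℝ] E)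
  let p : Polynomial ℝ := Matrix.det ((Polynomial.X : Polynomial ℝ) • M.map Polynomial.C +
    (1 : Matrix _ _ ℝ).map Polynomial.C)
  have hp (t : ℝ) : p.eval t = (1 + t • A).det := by
    have h1 : (1 + t • A).det = Matrix.det (t • M + 1) := by
      rw [ContinuousLinearMap.det, ← LinearMap.det_toMatrix b]
      have h2 : ((1 + t • A : E →L[ℝ] E) : E →ₗ[ℝ] E) = t • (A : E →ₗ[ℝ] E) + 1 := by
        rw [add_comm]
        rfl
      rw [h2, map_add, map_smul, LinearMap.toMatrix_one]
    rw [h1, ← Polynomial.coe_evalRingHom, RingHom.map_det]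
    congr 1
    ext i j
    by_cases hij : i = j
    · subst hij
      simp [-mul_eq_mul_right_iff, mul_comm t]
    · simp [hij, mul_comm t]
  have hdeg : p.degree < (Finset.range (finrank ℝ E + 1)).card := by
    rw [Finset.card_range]
    refine (Polynomial.degree_le_natDegree).trans_lt ?_
    have := Polynomial.natDegree_det_X_add_C_le M 1
    rw [Fintype.card_fin] at this
    exact_mod_cast Nat.lt_succ_of_le this
  have h := congrArg (Polynomial.eval 1) (Lagrange.eq_interpolate hv hdeg)
  simpa [Lagrange.interpolate_apply, Polynomial.eval_finsetSum, hp] using h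

theorem ContinuousLinearMap.det_one_add_pos {A : E →L[ℝ] E} (hA : ‖A‖ < 1) :
    0 < (1 + A).det := by
  have hne (s : ℝ) (hs : s ∈ Icc (0 : ℝ) 1) : (1 + s • A).det ≠ 0 := by
    have hn : ‖-(s • A)‖ < 1 := by
      rw [norm_neg, norm_smul, Real.norm_of_nonneg hs.1]
      exact (mul_le_of_le_one_left (norm_nonneg _) hs.2).trans_lt hA
    have hu := isUnit_one_sub_of_norm_lt_one hn
    rw [sub_neg_eq_add] at hu
    have := hu.map (ContinuousLinearMap.toLinearMapRingHom (R₁ := ℝ) (M₁ := E))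
    exact ((LinearMap.isUnit_iff_isUnit_det _).1 this).ne_zero
  have hc : ContinuousOn (fun s : ℝ => (1 + s • A).det) (Icc 0 1) :=
    (ContinuousLinearMap.continuous_det.comp (by fun_prop)).continuousOn
  by_contra! hle
  have h0 : (0 : ℝ) ∈ Icc ((1 + (1 : ℝ) • A).det) ((1 + (0 : ℝ) • A).det) := by
    refine ⟨by simpa using hle, ?_⟩
    rw [zero_smul, add_zero, ContinuousLinearMap.det]
    simp
  obtain ⟨s, hs, hs0⟩ := intermediate_value_Icc' zero_le_one hc h0
  exact hne s hs hs0

/-- A small Lipschitz perturbation of the identity which is supported on `S` permutes `S`. -/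
theorem LipschitzWith.injective_id_add_and_image_eq {u : E → E} {K : ℝ≥0} (hu : LipschitzWith K u)
    (hK : K < 1) {S : Set E} (hS : ∀ x ∉ S, u x = 0) :
    Function.Injective (fun x => x + u x) ∧ (fun x => x + u x) '' S = S := by
  have hinj : Function.Injective (fun x => x + u x) := by
    intro x y hxy
    have h1 : x - y = u y - u x := by
      rw [sub_eq_sub_iff_add_eq_add, add_comm (u y)]
      exact hxy
    by_contra hne
    have h2 := hu.dist_le_mul y x
    rw [dist_eq_norm, dist_comm, dist_eq_norm, ← h1] at h2
    have h3 : 0 < ‖x - y‖ := norm_pos_iff.2 (sub_ne_zero.2 hne)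
    have h4 : (K : ℝ) < 1 := hK
    nlinarith
  refine ⟨hinj, ?_⟩
  ext y
  constructor
  · rintro ⟨x, hx, rfl⟩
    by_contra hy
    have h : x + u x = x := hinj (by simp [hS _ hy])
    exact hy (by simpa [h] using hx)
  · intro hy
    have hc : ContractingWith K (fun x => y - u x) := by
      refine ⟨hK, LipschitzWith.of_dist_le_mul fun a b => ?_⟩
      rw [dist_sub_left]
      exact hu.dist_le_mul a b
    have hx := hc.fixedPoint_isFixedPt
    set x := hc.fixedPoint
    have hxy : x + u x = y := by
      nth_rewrite 1 [← hx]
      simp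
    refine ⟨x, ?_, hxy⟩
    by_contra hxS
    rw [hS x hxS, add_zero] at hxy
    exact hxS (hxy ▸ hy)

variable [MeasurableSpace E] [BorelSpace E] (μ : Measure E) [μ.IsAddHaarMeasure]

theorem LipschitzWith.addHaar_image_eq_zero {f : E → E} {K : ℝ≥0} (hf : LipschitzWith K f)
    {s : Set E} (hs : μ s = 0) : μ (f '' s) = 0 := by
  have h1 : μ ≪ Measure.hausdorffMeasure (finrank ℝ E) :=
    Measure.absolutelyContinuous_isAddHaarMeasure _ _
  have h2 : Measure.hausdorffMeasure (finrank ℝ E) ≪ μ :=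
    Measure.absolutelyContinuous_isAddHaarMeasure _ _
  apply h1
  refine le_antisymm ((hf.hausdorffMeasure_image_le (Nat.cast_nonneg _) s).trans ?_) zero_le
  simp [h2 hs]

theorem LipschitzWith.integral_det_one_add_fderiv_of_lt_one {u : E → E} {K : ℝ≥0}
    (hu : LipschitzWith K u) (hK : K < 1) {S : Set E} (hSm : MeasurableSet S) (hSf : μ S ≠ ⊤)
    (hS : ∀ x ∉ S, u x = 0) :
    IntegrableOn (fun x => (1 + fderiv ℝ u x).det) S μ ∧
      ∫ x in S, (1 + fderiv ℝ u x).det ∂μ = μ.real S := by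
  obtain ⟨hinj, himg⟩ := hu.injective_id_add_and_image_eq hK hS
  set g : E → E := fun x => x + u x with hg
  have hgl : LipschitzWith (1 + K) g := LipschitzWith.id.add hu
  set T : Set E := S ∩ {x | DifferentiableAt ℝ u x} with hT
  have hTm : MeasurableSet T := hSm.inter (measurableSet_of_differentiableAt ℝ u)
  have hN : μ (S \ T) = 0 := by
    refine measure_mono_null ?_ (ae_iff.1 (hu.ae_differentiableAt (μ := μ)))
    rintro x ⟨hxS, hxT⟩ hx
    exact hxT ⟨hxS, hx⟩
  have hTS : T =ᵐ[μ] S :=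
    inter_subset_left.eventuallyLE.antisymm (ae_le_set.2 hN)
  have hgT : g '' T =ᵐ[μ] S := by
    refine (LE.le.eventuallyLE ?_).antisymm (ae_le_set.2 ?_)
    · exact (image_mono inter_subset_left).trans himg.subset
    · refine measure_mono_null ?_ (hgl.addHaar_image_eq_zero μ hN)
      nth_rewrite 1 [← himg]
      rw [image_sdiff hinj]
  have hder : ∀ x ∈ T, HasFDerivWithinAt g (1 + fderiv ℝ u x) T x := fun x hx =>
    ((hasFDerivAt_id x).add hx.2.hasFDerivAt).hasFDerivWithinAt
  have hdet (x : E) : |(1 + fderiv ℝ u x).det| = (1 + fderiv ℝ u x).det :=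
    abs_of_pos (ContinuousLinearMap.det_one_add_pos
      ((norm_fderiv_le_of_lipschitz ℝ hu).trans_lt hK))
  have hI := integrableOn_image_iff_integrableOn_abs_det_fderiv_smul μ hTm hder hinj.injOn
    (fun _ => (1 : ℝ))
  have hJ := integral_image_eq_integral_abs_det_fderiv_smul μ hTm hder hinj.injOn
    (fun _ => (1 : ℝ))
  simp only [hdet, smul_eq_mul, mul_one] at hI hJ
  rw [integrableOn_congr_set_ae hgT, integrableOn_congr_set_ae hTS] at hI
  rw [setIntegral_congr_set hgT, setIntegral_congr_set hTS] at hJ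
  refine ⟨hI.1 (integrableOn_const hSf), ?_⟩
  rw [← hJ]
  simp

/-- The integral of the Jacobian of a Lipschitz map which is the identity outside `S`. -/
theorem LipschitzWith.integral_det_one_add_fderiv {u : E → E} {K : ℝ≥0}
    (hu : LipschitzWith K u) {S : Set E} (hSm : MeasurableSet S) (hSf : μ S ≠ ⊤)
    (hS : ∀ x ∉ S, u x = 0) :
    ∫ x in S, (1 + fderiv ℝ u x).det ∂μ = μ.real S := by
  let v : ℕ → ℝ≥0 := fun j => ((K + 1) * (j + 1))⁻¹
  have hv (j : ℕ) : v j * K < 1 := by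
    have hpos : 0 < (K + 1) * ((j : ℝ≥0) + 1) := by positivity
    rw [inv_mul_lt_iff₀ hpos, mul_one]
    calc K < K + 1 := lt_add_one K
      _ ≤ (K + 1) * (j + 1) := le_mul_of_one_le_right zero_le (by simp)
  have hvi : Function.Injective (fun j => (v j : ℝ)) := by
    intro i j hij
    have h : v i = v j := NNReal.coe_injective hij
    have hK : K + 1 ≠ 0 := by positivity
    simpa [v, hK] using h
  have hmain (j : ℕ) : IntegrableOn (fun x => (1 + (v j : ℝ) • fderiv ℝ u x).det) S μ ∧
      ∫ x in S, (1 + (v j : ℝ) • fderiv ℝ u x).det ∂μ = μ.real S := by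
    have hl : LipschitzWith (v j * K) (fun x => (v j : ℝ) • u x) :=
      LipschitzWith.of_dist_le_mul fun x y => by
        rw [dist_smul₀, Real.norm_of_nonneg (v j).coe_nonneg, NNReal.coe_mul, mul_assoc]
        gcongr
        exact hu.dist_le_mul x y
    have hfd : fderiv ℝ (fun x => (v j : ℝ) • u x) = fun x => (v j : ℝ) • fderiv ℝ u x :=
      fderiv_const_smul_field (v j : ℝ)
    have := hl.integral_det_one_add_fderiv_of_lt_one μ (hv j) hSm hSf
      (fun x hx => by simp [hS x hx])
    rwa [hfd] at this
  have hdet := funext fun x =>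
    (fderiv ℝ u x).det_one_add_eq_sum (v := fun j => (v j : ℝ)) hvi.injOn
  rw [hdet, integral_finsetSum _ fun j _ => (hmain j).1.mul_const _]
  simp_rw [integral_mul_const, (hmain _).2]
  rw [← Finset.mul_sum, ← Polynomial.eval_finsetSum, Lagrange.sum_basis hvi.injOn (by simp)]
  simp

end Degree

section Openness

theorem norm_inv_norm_smul_sub_le {E : Type*} [NormedAddCommGroup E] [NormedSpace ℝ E] {v w : E}
    (hv : v ≠ 0) (hw : w ≠ 0) :
    ‖‖v‖⁻¹ • v - ‖w‖⁻¹ • w‖ ≤ 2 * ‖v - w‖ / ‖w‖ := by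
  have hv' : 0 < ‖v‖ := norm_pos_iff.2 hv
  have hw' : 0 < ‖w‖ := norm_pos_iff.2 hw
  have h : ‖v‖⁻¹ • v - ‖w‖⁻¹ • w = (‖v‖⁻¹ - ‖w‖⁻¹) • v + ‖w‖⁻¹ • (v - w) := by
    module
  have h1 : ‖(‖v‖⁻¹ - ‖w‖⁻¹) • v‖ ≤ ‖w‖⁻¹ * ‖v - w‖ := by
    have h2 : ‖v‖⁻¹ - ‖w‖⁻¹ = (‖w‖ - ‖v‖) * (‖v‖⁻¹ * ‖w‖⁻¹) := by
      field_simp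
    rw [norm_smul, h2, norm_mul, Real.norm_of_nonneg (by positivity : 0 ≤ ‖v‖⁻¹ * ‖w‖⁻¹)]
    calc ‖‖w‖ - ‖v‖‖ * (‖v‖⁻¹ * ‖w‖⁻¹) * ‖v‖ = ‖w‖⁻¹ * ‖‖w‖ - ‖v‖‖ := by field_simp
      _ ≤ ‖w‖⁻¹ * ‖v - w‖ := by
        gcongr
        rw [norm_sub_rev v w]
        exact abs_norm_sub_norm_le w v
  calc ‖‖v‖⁻¹ • v - ‖w‖⁻¹ • w‖ ≤ ‖(‖v‖⁻¹ - ‖w‖⁻¹) • v‖ + ‖‖w‖⁻¹ • (v - w)‖ := by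
        rw [h]; exact norm_add_le _ _
    _ ≤ ‖w‖⁻¹ * ‖v - w‖ + ‖w‖⁻¹ * ‖v - w‖ := by
        gcongr
        rw [norm_smul, Real.norm_of_nonneg (by positivity)]
    _ = 2 * ‖v - w‖ / ‖w‖ := by ring

variable {E : Type*} [NormedAddCommGroup E] [InnerProductSpace ℝ E] [FiniteDimensional ℝ E]

theorem HasFDerivAt.det_eq_zero_of_norm_eventually_const {h : E → E} {L : E →L[ℝ] E} {x : E}
    (hL : HasFDerivAt h L x) {R : ℝ} (hR : 0 < R) (hconst : ∀ᶠ y in 𝓝 x, ‖h y‖ = R) :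
    L.det = 0 := by
  by_contra hdet
  obtain ⟨w, hw⟩ := (L.toContinuousLinearEquivOfDetNeZero hdet).surjective (h x)
  have h1 : HasFDerivAt (fun _ : E => R ^ 2) (2 • (innerSL ℝ (h x)).comp L) x :=
    hL.norm_sq.congr_of_eventuallyEq (hconst.mono fun y hy => by simp [hy])
  have h2 := DFunLike.congr_fun (h1.unique (hasFDerivAt_const (R ^ 2) x)) w
  rw [ContinuousLinearMap.toContinuousLinearEquivOfDetNeZero_apply] at hw
  simp [hw, hconst.self_of_nhds, hR.ne'] at h2

theorem LipschitzWith.exists_eq_zero_of_eq_id {g : E → E} {K : ℝ≥0} (hg : LipschitzWith K g)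
    {R : ℝ} (hR : 0 < R) (hid : ∀ x, R ≤ ‖x‖ → g x = x) : ∃ x, g x = 0 := by
  by_contra! hne
  borelize E
  obtain ⟨c, hc, hcg⟩ : ∃ c > 0, ∀ x, c ≤ ‖g x‖ := by
    obtain ⟨x₀, -, hx₀⟩ := (isCompact_closedBall (0 : E) R).exists_isMinOn
      ⟨0, by simp [hR.le]⟩ hg.continuous.norm.continuousOn
    refine ⟨min R ‖g x₀‖, lt_min hR (norm_pos_iff.2 (hne x₀)), fun x => ?_⟩
    rcases le_total R ‖x‖ with hx | hx
    · rw [hid x hx]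
      exact (min_le_left _ _).trans hx
    · exact (min_le_right _ _).trans (hx₀ (by simpa using hx))
  obtain ⟨C, hC0, hC⟩ : ∃ C : ℝ, 0 ≤ C ∧ ∀ x, max ‖x‖ R ≤ C * ‖g x‖ := by
    refine ⟨max 1 (R / c), by positivity, fun x => ?_⟩
    rcases le_total R ‖x‖ with hx | hx
    · rw [hid x hx, max_eq_left hx]
      exact le_mul_of_one_le_left (norm_nonneg _) (le_max_left _ _)
    · rw [max_eq_right hx]
      calc R = R / c * c := by field_simp
        _ ≤ max 1 (R / c) * ‖g x‖ := by
          gcongr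
          · exact le_max_right _ _
          · exact hcg x
  let h : E → E := fun x => max ‖x‖ R • (‖g x‖⁻¹ • g x)
  have hunit (x : E) : ‖‖g x‖⁻¹ • g x‖ = 1 := by
    rw [norm_smul, norm_inv, norm_norm, inv_mul_cancel₀ (norm_ne_zero_iff.2 (hne x))]
  have hh : LipschitzWith (1 + 2 * C.toNNReal * K) h := by
    refine LipschitzWith.of_dist_le_mul fun x y => ?_
    have e : h x - h y = (max ‖x‖ R - max ‖y‖ R) • (‖g x‖⁻¹ • g x) +
        max ‖y‖ R • (‖g x‖⁻¹ • g x - ‖g y‖⁻¹ • g y) := by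
      simp only [h]
      module
    have hy : 0 < ‖g y‖ := norm_pos_iff.2 (hne y)
    have h1 : ‖(max ‖x‖ R - max ‖y‖ R) • (‖g x‖⁻¹ • g x)‖ ≤ ‖x - y‖ := by
      rw [norm_smul, hunit, mul_one, Real.norm_eq_abs]
      exact (abs_max_sub_max_le_abs _ _ _).trans (abs_norm_sub_norm_le x y)
    have h2 : ‖max ‖y‖ R • (‖g x‖⁻¹ • g x - ‖g y‖⁻¹ • g y)‖ ≤ 2 * C * K * ‖x - y‖ := by
      rw [norm_smul, Real.norm_of_nonneg (by positivity)]
      calc max ‖y‖ R * ‖‖g x‖⁻¹ • g x - ‖g y‖⁻¹ • g y‖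
          ≤ (C * ‖g y‖) * (2 * ‖g x - g y‖ / ‖g y‖) := by
            gcongr
            · exact hC y
            · exact norm_inv_norm_smul_sub_le (hne x) (hne y)
        _ = 2 * C * ‖g x - g y‖ := by field_simp
        _ ≤ 2 * C * (K * ‖x - y‖) := by
            gcongr
            exact hg.norm_sub_le x y
        _ = 2 * C * K * ‖x - y‖ := by ring
    rw [dist_eq_norm, dist_eq_norm, e]
    refine (norm_add_le _ _).trans ((add_le_add h1 h2).trans_eq ?_)
    push_cast
    rw [Real.coe_toNNReal _ hC0]
    ring
  have hu : LipschitzWith _ (fun x => h x - x) := hh.sub LipschitzWith.id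
  have hball : ∀ x ∉ ball (0 : E) R, h x - x = 0 := by
    intro x hx
    have hx' : R ≤ ‖x‖ := by simpa using hx
    have : ‖x‖ ≠ 0 := (hR.trans_le hx').ne'
    simp [h, hid x hx', hx', this]
  let μ : Measure E := Measure.addHaar
  have hint := hu.integral_det_one_add_fderiv μ measurableSet_ball
    (measure_ball_lt_top (μ := μ)).ne hball
  have hzero : ∀ᵐ x ∂μ, x ∈ ball (0 : E) R → (1 + fderiv ℝ (fun x => h x - x) x).det = 0 := by
    filter_upwards [hu.ae_differentiableAt (μ := μ)] with x hx hxR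
    have hd : HasFDerivAt h (1 + fderiv ℝ (fun x => h x - x) x) x :=
      ((hasFDerivAt_id x).add hx.hasFDerivAt).congr_of_eventuallyEq
        (Eventually.of_forall fun y => by simp)
    refine hd.det_eq_zero_of_norm_eventually_const hR ?_
    filter_upwards [isOpen_ball.mem_nhds hxR] with y hy
    have hy' : ‖y‖ ≤ R := by simpa using (mem_ball.1 hy).le
    simp only [h]
    rw [norm_smul, hunit, max_eq_right hy', mul_one, Real.norm_of_nonneg hR.le]
  rw [setIntegral_congr_ae measurableSet_ball hzero, integral_zero] at hint
  have hpos : 0 < μ.real (ball (0 : E) R) :=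
    ENNReal.toReal_pos (measure_ball_pos μ 0 hR).ne' measure_ball_lt_top.ne
  exact hpos.ne hint

/-- A Lipschitz map whose derivative at `x` is invertible is open at `x`. -/
theorem LipschitzWith.image_mem_nhds_of_det_ne_zero {f : E → E} {K : ℝ≥0} (hf : LipschitzWith K f)
    {L : E →L[ℝ] E} {x : E} (hL : HasFDerivAt f L x) (hdet : L.det ≠ 0) {U : Set E}
    (hU : U ∈ 𝓝 x) : f '' U ∈ 𝓝 (f x) := by
  let e : E ≃L[ℝ] E := L.toContinuousLinearEquivOfDetNeZero hdet
  have he : (e : E →L[ℝ] E) = L := rfl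
  let w : E → E := fun y => e.symm (f (x + y) - f x) - y
  obtain ⟨M, hw⟩ : ∃ M : ℝ≥0, LipschitzWith M w := by
    have h1 : LipschitzWith (K * 1 + 0) (fun y => f (x + y) - f x) :=
      (hf.comp (LipschitzWith.of_dist_le_mul fun a b => by simp)).sub (LipschitzWith.const _)
    exact ⟨_, (e.symm.lipschitz.comp h1).sub LipschitzWith.id⟩
  have hw0 : w 0 = 0 := by simp [w]
  have hwd : HasFDerivAt w (0 : E →L[ℝ] E) 0 := by
    have h1 : HasFDerivAt (fun y => f (x + y) - f x) L 0 := by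
      refine HasFDerivAt.sub_const _ ?_
      rw [hasFDerivAt_comp_add_left]
      simpa using hL
    have h2 := (e.symm.hasFDerivAt.comp (0 : E) h1).sub (hasFDerivAt_id (0 : E))
    have h3 : (e.symm : E →L[ℝ] E).comp L - ContinuousLinearMap.id ℝ E = 0 := by
      rw [← he]
      ext y
      simp
    rwa [h3] at h2
  obtain ⟨δ, hδ, hδw, hδU⟩ : ∃ δ > 0, (∀ y, ‖y‖ ≤ δ → ‖w y‖ ≤ 1 / 4 * ‖y‖) ∧
      ∀ y, ‖y‖ ≤ δ → x + y ∈ U := by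
    have h1 : ∀ᶠ y in 𝓝 (0 : E), ‖w y‖ ≤ 1 / 4 * ‖y‖ := by
      have := hwd.isLittleO.bound (by norm_num : (0 : ℝ) < 1 / 4)
      simpa [hw0] using this
    have h2 : ∀ᶠ y in 𝓝 (0 : E), x + y ∈ U :=
      (Continuous.tendsto' (by fun_prop) 0 x (by simp)).eventually hU
    obtain ⟨δ, hδ, h⟩ := nhds_basis_closedBall.eventually_iff.1 (h1.and h2)
    exact ⟨δ, hδ, fun y hy => (h (by simpa using hy)).1, fun y hy => (h (by simpa using hy)).2⟩
  let φ : E → ℝ := fun y => min 1 (max 0 (2 - 2 / δ * ‖y‖))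
  have hφ0 (y : E) : 0 ≤ φ y := by positivity
  have hφ1 (y : E) : φ y ≤ 1 := min_le_left _ _
  have hφ_far (y : E) (hy : δ ≤ ‖y‖) : φ y = 0 := by
    have : 2 ≤ 2 / δ * ‖y‖ := by
      rw [div_mul_eq_mul_div, le_div_iff₀ hδ]
      linarith
    simp only [φ]
    rw [max_eq_left (by linarith), min_eq_right zero_le_one]
  have hφ_near (y : E) (hy : ‖y‖ ≤ δ / 2) : φ y = 1 := by
    have : 2 / δ * ‖y‖ ≤ 1 := by
      rw [div_mul_eq_mul_div, div_le_iff₀ hδ]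
      linarith
    simp only [φ]
    rw [max_eq_right (by linarith), min_eq_left (by linarith)]
  have hφl (a b : E) : |φ a - φ b| ≤ 2 / δ * ‖a - b‖ := by
    calc |φ a - φ b| ≤ |max 0 (2 - 2 / δ * ‖a‖) - max 0 (2 - 2 / δ * ‖b‖)| := by
          simp only [φ, min_comm (1 : ℝ)]
          exact (abs_min_sub_min_le_max _ _ _ _).trans (by simp)
      _ ≤ |(2 - 2 / δ * ‖a‖) - (2 - 2 / δ * ‖b‖)| := by
          simp only [max_comm (0 : ℝ)]
          exact abs_max_sub_max_le_abs _ _ _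
      _ = |2 / δ * (‖b‖ - ‖a‖)| := by
          congr 1
          ring
      _ = 2 / δ * |‖b‖ - ‖a‖| := by
          rw [abs_mul, abs_of_pos (by positivity : 0 < 2 / δ)]
      _ ≤ 2 / δ * ‖a - b‖ := by
          gcongr
          rw [norm_sub_rev]
          exact abs_norm_sub_norm_le b a
  have hφw : LipschitzWith (M + 1) (fun y => φ y • w y) := by
    have key (a b : E) (hab : ‖b‖ ≤ ‖a‖) : ‖φ a • w a - φ b • w b‖ ≤ (M + 1) * ‖a - b‖ := by
      rcases le_total δ ‖b‖ with hb | hb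
      · rw [hφ_far a (hb.trans hab), hφ_far b hb, zero_smul, zero_smul, sub_zero, norm_zero]
        positivity
      have h1 : ‖φ a • (w a - w b)‖ ≤ M * ‖a - b‖ := by
        rw [norm_smul, Real.norm_of_nonneg (hφ0 a)]
        exact (mul_le_of_le_one_left (norm_nonneg _) (hφ1 a)).trans (hw.norm_sub_le a b)
      have h2 : ‖(φ a - φ b) • w b‖ ≤ ‖a - b‖ := by
        rw [norm_smul, Real.norm_eq_abs]
        calc |φ a - φ b| * ‖w b‖ ≤ (2 / δ * ‖a - b‖) * (1 / 4 * δ) := by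
              gcongr
              · exact hφl a b
              · exact (hδw b hb).trans (by gcongr)
          _ = ‖a - b‖ / 2 := by
              field_simp
              ring
          _ ≤ ‖a - b‖ := half_le_self (norm_nonneg _)
      calc ‖φ a • w a - φ b • w b‖ = ‖φ a • (w a - w b) + (φ a - φ b) • w b‖ := by
            congr 1
            module
        _ ≤ (M + 1) * ‖a - b‖ := by
            refine (norm_add_le _ _).trans ((add_le_add h1 h2).trans_eq (by ring))
    refine LipschitzWith.of_dist_le_mul fun a b => ?_
    rw [dist_eq_norm, dist_eq_norm]
    rcases le_total ‖b‖ ‖a‖ with hab | hab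
    · exact_mod_cast key a b hab
    · rw [norm_sub_rev, norm_sub_rev a]
      exact_mod_cast key b a hab
  have hsurj (z : E) (hz : ‖z‖ < δ / 4) : ∃ y, ‖y‖ ≤ δ ∧ e.symm (f (x + y) - f x) = z := by
    have hG : LipschitzWith ((1 + (M + 1)) * 1 + 0)
        (fun y => ((y + z) + φ (y + z) • w (y + z)) - z) :=
      ((LipschitzWith.id.add hφw).comp (LipschitzWith.of_dist_le_mul fun a b => by simp)).sub
        (LipschitzWith.const z)
    have hnz := norm_nonneg z
    obtain ⟨y, hy⟩ := hG.exists_eq_zero_of_eq_id (R := δ + ‖z‖) (by positivity) (by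
      intro y hy
      have : δ ≤ ‖y + z‖ := by
        have := norm_sub_norm_le y (-z)
        rw [norm_neg, sub_neg_eq_add] at this
        linarith
      simp [hφ_far _ this])
    set p := y + z with hp
    rw [sub_eq_zero] at hy
    have hpδ : ‖p‖ ≤ δ := by
      by_contra! hlt
      rw [hφ_far p hlt.le, zero_smul, add_zero] at hy
      rw [hy] at hlt
      linarith
    have h1 : ‖φ p • w p‖ ≤ 1 / 4 * ‖p‖ := by
      rw [norm_smul, Real.norm_of_nonneg (hφ0 p)]
      exact (mul_le_of_le_one_left (norm_nonneg _) (hφ1 p)).trans (hδw p hpδ)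
    have h2 : ‖p‖ ≤ ‖z‖ + ‖φ p • w p‖ := by
      have := _root_.norm_sub_le (p + φ p • w p) (φ p • w p)
      rwa [add_sub_cancel_right, hy] at this
    rw [hφ_near p (by linarith), one_smul] at hy
    exact ⟨p, hpδ, by simpa [w] using hy⟩
  have hlim : Tendsto (fun q => e.symm (q - f x)) (𝓝 (f x)) (𝓝 0) :=
    Continuous.tendsto' (by fun_prop) (f x) 0 (by simp)
  filter_upwards [hlim (ball_mem_nhds (0 : E) (by positivity : 0 < δ / 4))] with q hq
  obtain ⟨y, hy, hyq⟩ := hsurj _ (mem_ball_zero_iff.1 hq)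
  exact ⟨x + y, hδU y hy, sub_left_injective (e.symm.injective hyq)⟩

variable [MeasurableSpace E] [BorelSpace E] (μ : Measure E) [μ.IsAddHaarMeasure]

/-- A Lipschitz map sends compact sets with null frontier to sets with null frontier. -/
theorem LipschitzWith.addHaar_frontier_image_eq_zero {f : E → E} {K : ℝ≥0}
    (hf : LipschitzWith K f) {s : Set E} (hs : IsCompact s) (hfr : μ (frontier s) = 0) :
    μ (frontier (f '' s)) = 0 := by
  let N : Set E := {x | ¬ DifferentiableAt ℝ f x}
  let Z : Set E := {x | DifferentiableAt ℝ f x ∧ (fderiv ℝ f x).det = 0}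
  have hN : μ (f '' N) = 0 :=
    hf.addHaar_image_eq_zero μ (ae_iff.1 (hf.ae_differentiableAt (μ := μ)))
  have hZ : μ (f '' Z) = 0 :=
    addHaar_image_eq_zero_of_det_fderivWithin_eq_zero μ
      (fun x hx => hx.1.hasFDerivAt.hasFDerivWithinAt) (fun x hx => hx.2)
  refine measure_mono_null (t := f '' frontier s ∪ (f '' N ∪ f '' Z)) ?_
    (measure_union_null (hf.addHaar_image_eq_zero μ hfr) (measure_union_null hN hZ))
  rw [(hs.image hf.continuous).isClosed.frontier_eq]
  rintro _ ⟨⟨x, hx, rfl⟩, hxi⟩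
  by_cases hxs : x ∈ interior s
  · right
    by_cases hd : DifferentiableAt ℝ f x
    · by_cases hdet : (fderiv ℝ f x).det = 0
      · exact Or.inr ⟨x, ⟨hd, hdet⟩, rfl⟩
      · exact absurd (mem_interior_iff_mem_nhds.2 (hf.image_mem_nhds_of_det_ne_zero hd.hasFDerivAt
          hdet (mem_interior_iff_mem_nhds.1 hxs))) hxi
    · exact Or.inl ⟨x, hd, rfl⟩
  · exact Or.inl ⟨x, ⟨subset_closure hx, hxs⟩, rfl⟩

end Openness

section NullFrontier

variable {X : Type*} [TopologicalSpace X] [MeasurableSpace X] {μ : Measure X}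

theorem measure_frontier_inter_eq_zero {s t : Set X} (hs : μ (frontier s) = 0)
    (ht : μ (frontier t) = 0) : μ (frontier (s ∩ t)) = 0 :=
  measure_mono_null ((frontier_inter_subset s t).trans
    (union_subset_union inter_subset_left inter_subset_right)) (measure_union_null hs ht)

theorem measure_iUnion_diff_interior_eq_zero {ι : Type*} [Countable ι] {s : ι → Set X}
    (hs : ∀ i, μ (frontier (s i)) = 0) : μ ((⋃ i, s i) \ interior (⋃ i, s i)) = 0 := by
  refine measure_mono_null ?_ (measure_iUnion_null hs)
  rintro x ⟨hx, hxi⟩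
  obtain ⟨i, hi⟩ := mem_iUnion.1 hx
  exact mem_iUnion.2 ⟨i, subset_closure hi,
    fun h => hxi (interior_mono (subset_iUnion s i) h)⟩

end NullFrontier

section PhiMap

variable {d k : ℕ} {f : Fin k → EuclideanSpace ℝ (Fin d) → EuclideanSpace ℝ (Fin d)}
  {D : Set (EuclideanSpace ℝ (Fin d))}

theorem mem_phiMap {X : Set (EuclideanSpace ℝ (Fin d))} {x : EuclideanSpace ℝ (Fin d)} :
    x ∈ PhiMap f X ↔ ∃ i, ∃ y ∈ X, f i y = x := by
  simp [PhiMap]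

theorem phiMap_mono {X Y : Set (EuclideanSpace ℝ (Fin d))} (h : X ⊆ Y) :
    PhiMap f X ⊆ PhiMap f Y :=
  iUnion_mono fun _ => image_mono h

theorem phiMap_diff_subset {X Y : Set (EuclideanSpace ℝ (Fin d))} :
    PhiMap f X \ PhiMap f Y ⊆ PhiMap f (X \ Y) := by
  rintro x ⟨hx, hxY⟩
  obtain ⟨i, y, hy, rfl⟩ := mem_phiMap.1 hx
  exact mem_phiMap.2 ⟨i, y, ⟨hy, fun h => hxY (mem_phiMap.2 ⟨i, y, h, rfl⟩)⟩, rfl⟩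

theorem isCompact_phiMap (hf : ∀ i, Continuous (f i)) {X : Set (EuclideanSpace ℝ (Fin d))}
    (hX : IsCompact X) : IsCompact (PhiMap f X) :=
  isCompact_iUnion fun i => hX.image (hf i)

theorem volume_frontier_phiMap_eq_zero {r : Fin k → ℝ≥0} (hf : ∀ i, LipschitzWith (r i) (f i))
    {X : Set (EuclideanSpace ℝ (Fin d))} (hX : IsCompact X) (hfr : volume (frontier X) = 0) :
    volume (frontier (PhiMap f X)) = 0 := by
  have h (i : Fin k) : volume (frontier (f i '' X)) = 0 :=
    (hf i).addHaar_frontier_image_eq_zero volume hX hfr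
  refine measure_mono_null ?_ (measure_iUnion_null h)
  rw [(isCompact_phiMap (fun i => (hf i).continuous) hX).isClosed.frontier_eq]
  rintro x ⟨hx, hxi⟩
  obtain ⟨i, hi⟩ := mem_iUnion.1 hx
  exact mem_iUnion.2 ⟨i, subset_closure hi,
    fun h => hxi (interior_mono (subset_iUnion (fun i => f i '' X) i) h)⟩

/-- The points of `D` which are reached from `D` by `n` applications of the maps `f i`
without leaving `D`. -/
def returnSet (f : Fin k → EuclideanSpace ℝ (Fin d) → EuclideanSpace ℝ (Fin d))
    (D : Set (EuclideanSpace ℝ (Fin d))) : ℕ → Set (EuclideanSpace ℝ (Fin d))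
  | 0 => D
  | n + 1 => D ∩ PhiMap f (returnSet f D n)

theorem returnSet_subset (n : ℕ) : returnSet f D n ⊆ D := by
  cases n with
  | zero => exact Subset.rfl
  | succ n => exact inter_subset_left

theorem antitone_returnSet : Antitone (returnSet f D) := by
  refine antitone_nat_of_succ_le fun n => ?_
  induction n with
  | zero => exact inter_subset_left
  | succ n ih => exact inter_subset_inter_right _ (phiMap_mono ih)

theorem isCompact_returnSet (hD : IsCompact D) (hf : ∀ i, Continuous (f i)) (n : ℕ) :
    IsCompact (returnSet f D n) := by
  induction n with
  | zero => exact hD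
  | succ n ih => exact hD.inter (isCompact_phiMap hf ih)

theorem volume_frontier_returnSet_eq_zero {r : Fin k → ℝ≥0}
    (hf : ∀ i, LipschitzWith (r i) (f i)) (hD : IsCompact D) (hfr : volume (frontier D) = 0)
    (n : ℕ) : volume (frontier (returnSet f D n)) = 0 := by
  induction n with
  | zero => exact hfr
  | succ n ih =>
    exact measure_frontier_inter_eq_zero hfr (volume_frontier_phiMap_eq_zero hf
      (isCompact_returnSet hD (fun i => (hf i).continuous) n) ih)

theorem volume_frontier_returnSet_diff_eq_zero {r : Fin k → ℝ≥0}
    (hf : ∀ i, LipschitzWith (r i) (f i)) (hD : IsCompact D) (hfr : volume (frontier D) = 0)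
    (m n : ℕ) : volume (frontier (returnSet f D m \ returnSet f D n)) = 0 := by
  rw [sdiff_eq]
  refine measure_frontier_inter_eq_zero (volume_frontier_returnSet_eq_zero hf hD hfr m) ?_
  rw [frontier_compl]
  exact volume_frontier_returnSet_eq_zero hf hD hfr n

theorem iInter_returnSet_subset_attractor {r : Fin k → ℝ≥0} (hf : ∀ i, ContractingWith (r i) (f i))
    (hD : IsCompact D) {E : Set (EuclideanSpace ℝ (Fin d))} (hE : E.Nonempty) (hEc : IsCompact E)
    (hEfix : E = ⋃ i, f i '' E) : ⋂ n, returnSet f D n ⊆ E := by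
  let ρ : ℝ≥0 := Finset.univ.sup r
  have hρ : ρ < 1 := (Finset.sup_lt_iff zero_lt_one).2 fun i _ => (hf i).1
  obtain ⟨C, hC⟩ := (hD.image (continuous_infDist_pt E)).bddAbove
  have hstep (i : Fin k) (y : EuclideanSpace ℝ (Fin d)) :
      infDist (f i y) E ≤ ρ * infDist y E := by
    obtain ⟨e, he, hye⟩ := hEc.exists_infDist_eq_dist hE y
    have hfe : f i e ∈ E := by
      rw [hEfix]
      exact mem_iUnion.2 ⟨i, e, he, rfl⟩
    calc infDist (f i y) E ≤ dist (f i y) (f i e) := infDist_le_dist_of_mem hfe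
      _ ≤ r i * dist y e := (hf i).2.dist_le_mul y e
      _ ≤ ρ * infDist y E := by
        rw [hye]
        gcongr
        exact Finset.le_sup (f := r) (Finset.mem_univ i)
  have hbound (n : ℕ) : ∀ x ∈ returnSet f D n, infDist x E ≤ ρ ^ n * C := by
    induction n with
    | zero =>
      intro x hx
      simpa using hC ⟨x, hx, rfl⟩
    | succ n ih =>
      rintro x ⟨-, hx⟩
      obtain ⟨i, y, hy, rfl⟩ := mem_phiMap.1 hx
      calc infDist (f i y) E ≤ ρ * infDist y E := hstep i y
        _ ≤ ρ * (ρ ^ n * C) := by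
          gcongr
          exact ih y hy
        _ = ρ ^ (n + 1) * C := by ring
  intro x hx
  have hlim : Tendsto (fun n : ℕ => (ρ : ℝ) ^ n * C) atTop (𝓝 (0 * C)) :=
    (tendsto_pow_atTop_nhds_zero_of_lt_one ρ.coe_nonneg hρ).mul_const C
  rw [zero_mul] at hlim
  have h0 : infDist x E ≤ 0 :=
    ge_of_tendsto' hlim fun n => hbound n x (mem_iInter.1 hx n)
  exact (hEc.isClosed.mem_iff_infDist_zero hE).2 (h0.antisymm infDist_nonneg)

/-- The points of `D` for which the maximal number of backward steps inside `D` is even. -/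
def evenReturnSet (f : Fin k → EuclideanSpace ℝ (Fin d) → EuclideanSpace ℝ (Fin d))
    (D : Set (EuclideanSpace ℝ (Fin d))) : Set (EuclideanSpace ℝ (Fin d)) :=
  ⋃ n : ℕ, returnSet f D (2 * n) \ returnSet f D (2 * n + 1)

/-- The points of `D` for which the maximal number of backward steps inside `D` is odd. -/
def oddReturnSet (f : Fin k → EuclideanSpace ℝ (Fin d) → EuclideanSpace ℝ (Fin d))
    (D : Set (EuclideanSpace ℝ (Fin d))) : Set (EuclideanSpace ℝ (Fin d)) :=
  ⋃ n : ℕ, returnSet f D (2 * n + 1) \ returnSet f D (2 * n + 2)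

theorem evenReturnSet_subset : evenReturnSet f D ⊆ D :=
  iUnion_subset fun n => sdiff_subset.trans (returnSet_subset (2 * n))

theorem disjoint_evenReturnSet_oddReturnSet : Disjoint (evenReturnSet f D) (oddReturnSet f D) := by
  rw [Set.disjoint_left]
  rintro x hx hx'
  obtain ⟨m, hm, hm'⟩ := mem_iUnion.1 hx
  obtain ⟨n, hn, hn'⟩ := mem_iUnion.1 hx'
  rcases lt_or_ge n m with h | h
  · exact hn' (antitone_returnSet (by lia) hm)
  · exact hm' (antitone_returnSet (by lia) hn)

theorem subset_even_union_odd_union_iInter :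
    D ⊆ evenReturnSet f D ∪ (oddReturnSet f D ∪ ⋂ n, returnSet f D n) := by
  intro x hx
  by_cases h : x ∈ ⋂ n, returnSet f D n
  · exact Or.inr (Or.inr h)
  obtain ⟨n, hin, hout⟩ : ∃ n, x ∈ returnSet f D n ∧ x ∉ returnSet f D (n + 1) := by
    by_contra! hstep
    exact h (mem_iInter.2 fun n => n.rec hx hstep)
  obtain ⟨m, rfl | rfl⟩ := n.even_or_odd'
  · exact Or.inl (mem_iUnion.2 ⟨m, hin, hout⟩)
  · exact Or.inr (Or.inl (mem_iUnion.2 ⟨m, hin, hout⟩))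

theorem oddReturnSet_subset_phiMap : oddReturnSet f D ⊆ PhiMap f (evenReturnSet f D) := by
  refine iUnion_subset fun n => ?_
  rintro x ⟨⟨hxD, hx⟩, hx'⟩
  refine phiMap_mono ?_ (phiMap_diff_subset ⟨hx, fun h => hx' ⟨hxD, h⟩⟩)
  exact subset_iUnion (fun n => returnSet f D (2 * n) \ returnSet f D (2 * n + 1)) n

theorem phiMap_evenReturnSet_subset (h1 : PhiMap f (D \ PhiMap f D) ⊆ D)
    (h2 : PhiMap f (D ∩ PhiMap f (PhiMap f D)) ⊆ D) : PhiMap f (evenReturnSet f D) ⊆ D := by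
  intro x hx
  obtain ⟨i, y, hy, rfl⟩ := mem_phiMap.1 hx
  obtain ⟨n, hn, hn'⟩ := mem_iUnion.1 hy
  rcases n with _ | n
  · exact h1 (mem_phiMap.2 ⟨i, y, ⟨hn, fun h => hn' ⟨hn, h⟩⟩, rfl⟩)
  · obtain ⟨hyD, hy2⟩ : y ∈ returnSet f D 2 := antitone_returnSet (by lia) hn
    exact h2 (mem_phiMap.2 ⟨i, y, ⟨hyD, phiMap_mono inter_subset_right hy2⟩, rfl⟩)

theorem evenReturnSet_inter_image_subset (hinj : ∀ i, Function.Injective (f i)) (i : Fin k) :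
    evenReturnSet f D ∩ f i '' evenReturnSet f D ⊆ ⋃ j, ⋃ (_ : i ≠ j), f i '' D ∩ f j '' D := by
  rintro _ ⟨hx, y, hy, rfl⟩
  have hxD := evenReturnSet_subset hx
  obtain ⟨n, hn, hn'⟩ := mem_iUnion.1 hy
  have hx1 : f i y ∈ returnSet f D (2 * n + 1) := ⟨hxD, mem_phiMap.2 ⟨i, y, hn, rfl⟩⟩
  have hx2 : f i y ∈ returnSet f D (2 * n + 2) := by
    by_contra h
    exact Set.disjoint_left.1 disjoint_evenReturnSet_oddReturnSet hx (mem_iUnion.2 ⟨n, hx1, h⟩)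
  obtain ⟨j, z, hz, hzx⟩ := mem_phiMap.1 hx2.2
  have hij : i ≠ j := by
    rintro rfl
    exact hn' (hinj i hzx ▸ hz)
  exact mem_iUnion₂.2 ⟨j, hij, ⟨y, evenReturnSet_subset hy, rfl⟩, z, returnSet_subset _ hz, hzx⟩

end PhiMap

/-- A non-overlapping family of injective contractions whose attractor has measure
zero and which satisfies `Φ(D \ Φ(D)) ⊆ D` and `Φ(D ∩ Φ²(D)) ⊆ D` admits a
dissection of `D`. -/
theorem dissection_of_nonoverlapping_family {d k : ℕ}
    (D : Set (EuclideanSpace ℝ (Fin d))) (hDc : IsCompact D)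
    (hDcl : D = closure (interior D)) (hfr : volume (frontier D) = 0)
    (f : Fin k → EuclideanSpace ℝ (Fin d) → EuclideanSpace ℝ (Fin d))
    (r : Fin k → NNReal) (hf : ∀ i, ContractingWith (r i) (f i))
    (hinj : ∀ i, Function.Injective (f i))
    (E : Set (EuclideanSpace ℝ (Fin d))) (hE : E.Nonempty) (hEc : IsCompact E)
    (hEfix : E = ⋃ i, f i '' E) (hEvol : volume E = 0)
    (hnov : ∀ i j, i ≠ j → volume (f i '' D ∩ f j '' D) = 0)
    (h1 : PhiMap f (D \ PhiMap f D) ⊆ D)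
    (h2 : PhiMap f (D ∩ PhiMap f (PhiMap f D)) ⊆ D) :
    ∃ X : Set (EuclideanSpace ℝ (Fin d)), IsCompact X ∧ X = closure (interior X) ∧
      D = X ∪ PhiMap f X ∧
      (∀ i, volume (X ∩ f i '' X) = 0) ∧
      (∀ i j, i ≠ j → volume (f i '' X ∩ f j '' X) = 0) := by
  let W := evenReturnSet f D
  let V := oddReturnSet f D
  let X := closure (interior W)
  have hfl (i : Fin k) : LipschitzWith (r i) (f i) := (hf i).2
  have hdiff := volume_frontier_returnSet_diff_eq_zero hfl hDc hfr
  have hW : volume (W \ interior W) = 0 :=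
    measure_iUnion_diff_interior_eq_zero fun n => hdiff (2 * n) (2 * n + 1)
  have hV : volume (V \ interior V) = 0 :=
    measure_iUnion_diff_interior_eq_zero fun n => hdiff (2 * n + 1) (2 * n + 2)
  have hI : volume (⋂ n, returnSet f D n) = 0 :=
    measure_mono_null (iInter_returnSet_subset_attractor hf hDc hE hEc hEfix) hEvol
  have hWX : volume (W \ X) = 0 :=
    measure_mono_null (sdiff_subset_sdiff_right subset_closure) hW
  have hXcl : X ⊆ closure W := closure_mono interior_subset
  have hXD : X ⊆ D := hXcl.trans (closure_minimal evenReturnSet_subset hDc.isClosed)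
  have hXW : volume (X \ W) = 0 := by
    refine measure_mono_null ?_ (measure_union_null hV hI)
    rintro x ⟨hx, hxW⟩
    rcases subset_even_union_odd_union_iInter (f := f) (hXD hx) with h | h | h
    · exact absurd h hxW
    · refine Or.inl ⟨h, fun hxi => ?_⟩
      exact Set.disjoint_left.1 ((disjoint_evenReturnSet_oddReturnSet.mono_right
        interior_subset).closure_left isOpen_interior) (hXcl hx) hxi
    · exact Or.inr h
  have hXc : IsCompact X := hDc.of_isClosed_subset isClosed_closure hXD
  have hΦXc : IsCompact (PhiMap f X) := isCompact_phiMap (fun i => (hfl i).continuous) hXc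
  have hΦXD : PhiMap f X ⊆ D := by
    refine iUnion_subset fun i => (image_mono hXcl).trans ?_
    refine (image_closure_subset_closure_image (hfl i).continuous).trans
      (closure_minimal ?_ hDc.isClosed)
    exact (subset_iUnion (fun i => f i '' W) i).trans (phiMap_evenReturnSet_subset h1 h2)
  have hΦ : volume (PhiMap f W \ PhiMap f X) = 0 := by
    refine measure_mono_null phiMap_diff_subset (measure_iUnion_null fun i => ?_)
    exact (hfl i).addHaar_image_eq_zero volume hWX
  have hcover : volume (D \ (X ∪ PhiMap f X)) = 0 := by
    refine measure_mono_null ?_ (measure_union_null hWX (measure_union_null hΦ hI))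
    rintro x ⟨hx, hxX⟩
    rw [mem_union, not_or] at hxX
    rcases subset_even_union_odd_union_iInter (f := f) hx with h | h | h
    · exact Or.inl ⟨h, hxX.1⟩
    · exact Or.inr (Or.inl ⟨oddReturnSet_subset_phiMap h, hxX.2⟩)
    · exact Or.inr (Or.inr h)
  have hclosed : IsClosed (X ∪ PhiMap f X) := hXc.isClosed.union hΦXc.isClosed
  refine ⟨X, hXc, closure_interior_idem.symm, ?_, fun i => ?_, fun i j hij => ?_⟩
  · refine Subset.antisymm ?_ (union_subset hXD hΦXD)
    rw [hDcl]
    refine closure_minimal ?_ hclosed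
    rw [← sdiff_eq_empty]
    exact (isOpen_interior.sdiff hclosed).eq_empty_of_measure_zero
      (measure_mono_null (sdiff_subset_sdiff_left interior_subset) hcover)
  · have hXi : volume (f i '' (X \ W)) = 0 := (hfl i).addHaar_image_eq_zero volume hXW
    have hWi : volume (W ∩ f i '' W) = 0 :=
      measure_mono_null (evenReturnSet_inter_image_subset hinj i)
        (measure_iUnion_null fun j => measure_iUnion_null fun h => hnov i j h)
    refine measure_mono_null ?_ (measure_union_null hXW (measure_union_null hXi hWi))
    rintro _ ⟨hx, y, hy, rfl⟩
    by_cases hxW : f i y ∈ W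
    · by_cases hyW : y ∈ W
      · exact Or.inr (Or.inr ⟨hxW, y, hyW, rfl⟩)
      · exact Or.inr (Or.inl ⟨y, ⟨hy, hyW⟩, rfl⟩)
    · exact Or.inl ⟨hx, hxW⟩
  · exact measure_mono_null (inter_subset_inter (image_mono hXD) (image_mono hXD)) (hnov i j hij)
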